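/- There exist constants c > 0 and C ≥ 0 such that for all integers k and S with 1 ≤ k ≤ S and every vector y ∈ ℝ^k with ‖y‖_∞ ≤ 1/2, one has ∑_{z ∈ ℤ^k, z ≠ 0} exp(−π S² ‖y + z‖₂²) ≤ C·exp(−c·S²). -/

import Mathlib

open Real

/-- A finite partial sum of a product function on `Fin k → α` is at most the `k`-th power of the
sum of the factor. -/
lemma sum_prod_le_tsum_pow {α : Type*} [DecidableEq α] {w : α → ℝ} (hw : Summable w)
    (hw0 : ∀ a, 0 ≤ w a) (k : ℕ) (s : Finset (Fin k → α)) :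
    ∑ z ∈ s, ∏ i, w (z i) ≤ (∑' a, w a) ^ k := by
  calc ∑ z ∈ s, ∏ i, w (z i)
      ≤ ∑ z ∈ Fintype.piFinset (fun i => s.image fun z => z i), ∏ i, w (z i) := by
        refine Finset.sum_le_sum_of_subset_of_nonneg (fun z hz => ?_)
          fun z _ _ => Finset.prod_nonneg fun i _ => hw0 _
        exact Fintype.mem_piFinset.2 fun i => Finset.mem_image_of_mem _ hz
    _ = ∏ i, ∑ a ∈ s.image (fun z => z i), w a := (Finset.prod_univ_sum _ _).symm
    _ ≤ ∏ _i : Fin k, ∑' a, w a :=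
        Finset.prod_le_prod (fun i _ => Finset.sum_nonneg fun a _ => hw0 a)
          fun i _ => hw.sum_le_tsum _ fun a _ => hw0 a
    _ = (∑' a, w a) ^ k := by simp

lemma summable_exp_neg_abs_int {b : ℝ} (hb : 0 < b) :
    Summable fun m : ℤ => rexp (-(b * |(m : ℝ)|)) := by
  have h : Summable fun n : ℕ => rexp (-(b * |(n : ℝ)|)) := by
    refine (summable_geometric_of_lt_one (exp_nonneg (-b))
      (exp_lt_one_iff.2 (neg_lt_zero.2 hb))).congr fun n => ?_
    rw [← Real.exp_nat_mul, Nat.abs_cast]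
    ring_nf
  exact Summable.of_nat_of_neg (by simpa using h) (by simpa using h)

lemma abs_div_four_le_add_sq {y : ℝ} (hy : |y| ≤ 1 / 2) (m : ℤ) :
    |(m : ℝ)| / 4 ≤ (y + m) ^ 2 := by
  rcases eq_or_ne m 0 with rfl | hm
  · simpa using sq_nonneg y
  · have h1 : (1 : ℝ) ≤ |(m : ℝ)| := by exact_mod_cast Int.one_le_abs hm
    have h2 : |(m : ℝ)| - |y| ≤ |y + m| := by
      have := abs_sub_abs_le_abs_sub (m : ℝ) (-y)
      rwa [abs_neg, sub_neg_eq_add, add_comm (m : ℝ)] at this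
    rw [← sq_abs (y + m)]
    nlinarith

lemma one_le_sum_abs_of_ne_zero {k : ℕ} {z : Fin k → ℤ} (hz : z ≠ 0) :
    (1 : ℝ) ≤ ∑ i, |(z i : ℝ)| := by
  obtain ⟨i, hi⟩ := Function.ne_iff.1 hz
  calc (1 : ℝ) ≤ |(z i : ℝ)| := by exact_mod_cast Int.one_le_abs hi
    _ ≤ ∑ i, |(z i : ℝ)| :=
      Finset.single_le_sum (f := fun i => |(z i : ℝ)|) (fun _ _ => abs_nonneg _)
        (Finset.mem_univ i)

lemma exp_neg_sum_add_sq_le {k : ℕ} {S : ℝ} (hS : 1 ≤ S) {y : Fin k → ℝ}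
    (hy : ∀ i, |y i| ≤ 1 / 2) {z : Fin k → ℤ} (hz : z ≠ 0) :
    rexp (-π * S ^ 2 * ∑ i, (y i + (z i : ℝ)) ^ 2) ≤
      rexp (-(π / 8 * S ^ 2)) * ∏ i, rexp (-(π / 8 * |(z i : ℝ)|)) := by
  rw [← Real.exp_sum, ← Real.exp_add, Real.exp_le_exp, Finset.sum_neg_distrib, ← Finset.mul_sum]
  have h1 := one_le_sum_abs_of_ne_zero hz
  have h2 : (∑ i, |(z i : ℝ)|) / 4 ≤ ∑ i, (y i + (z i : ℝ)) ^ 2 := by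
    rw [Finset.sum_div]
    exact Finset.sum_le_sum fun i _ => abs_div_four_le_add_sq (hy i) (z i)
  have h3 : S ^ 2 / 8 + (∑ i, |(z i : ℝ)|) / 8 ≤ S ^ 2 * ∑ i, (y i + (z i : ℝ)) ^ 2 := by
    nlinarith [mul_le_mul_of_nonneg_left h2 (sq_nonneg S),
      mul_nonneg (sub_nonneg.2 (one_le_pow₀ hS : 1 ≤ S ^ 2)) (zero_le_one.trans h1),
      mul_le_mul_of_nonneg_left h1 (sq_nonneg S)]
  linarith [mul_le_mul_of_nonneg_left h3 pi_pos.le]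

/-- **Discrete Gaussian sum over nonzero lattice translates.**  There are constants
`c > 0` and `C ≥ 0` such that for all integers `1 ≤ k ≤ S` and every `y ∈ ℝ^k` with
`‖y‖_∞ ≤ 1/2`, one has `∑_{z ∈ ℤ^k, z ≠ 0} exp(−π S² ‖y + z‖₂²) ≤ C·exp(−c S²)`. -/
theorem discrete_gaussian_nonzero_translate_estimate :
    ∃ c C : ℝ, 0 < c ∧ 0 ≤ C ∧
      ∀ k S : ℕ, 1 ≤ k → k ≤ S →
        ∀ y : Fin k → ℝ, (∀ i, |y i| ≤ 1 / 2) →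
          (∑' z : {z : Fin k → ℤ // z ≠ 0},
              Real.exp (-π * (S : ℝ) ^ 2 *
                (∑ i, (y i + ((z : Fin k → ℤ) i : ℝ)) ^ 2)))
            ≤ C * Real.exp (-c * (S : ℝ) ^ 2) := by
  have hπ := pi_pos
  set w : ℤ → ℝ := fun m => rexp (-(π / 8 * |(m : ℝ)|)) with hw_def
  have hw : Summable w := summable_exp_neg_abs_int (by positivity)
  have hw0 : ∀ m, 0 ≤ w m := fun m => exp_nonneg _
  set θ : ℝ := ∑' m, w m
  have hθ : 1 ≤ θ := by simpa [hw_def] using hw.le_tsum 0 fun m _ => hw0 m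
  set L : ℝ := Real.log θ
  refine ⟨π / 16, rexp (4 * L ^ 2 / π), by positivity, exp_nonneg _, fun k S hk hkS y hy => ?_⟩
  have hS : (1 : ℝ) ≤ S := by exact_mod_cast hk.trans hkS
  refine Real.tsum_le_of_sum_le (fun z => exp_nonneg _) fun s => ?_
  calc ∑ z ∈ s, rexp (-π * (S : ℝ) ^ 2 * ∑ i, (y i + ((z : Fin k → ℤ) i : ℝ)) ^ 2)
      ≤ ∑ z ∈ s, rexp (-(π / 8 * (S : ℝ) ^ 2)) * ∏ i, w ((z : Fin k → ℤ) i) :=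
        Finset.sum_le_sum fun z _ => exp_neg_sum_add_sq_le hS hy z.2
    _ = rexp (-(π / 8 * (S : ℝ) ^ 2)) *
          ∑ z ∈ s.map (Function.Embedding.subtype _), ∏ i, w (z i) := by
        rw [Finset.sum_map, Finset.mul_sum]
        rfl
    _ ≤ rexp (-(π / 8 * (S : ℝ) ^ 2)) * θ ^ S := by
        gcongr
        exact (sum_prod_le_tsum_pow hw hw0 k _).trans (pow_le_pow_right₀ hθ hkS)
    _ = rexp (-(π / 8 * (S : ℝ) ^ 2) + S * L) := by
        rw [Real.exp_add, Real.exp_nat_mul, Real.exp_log (by linarith)]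
    _ ≤ rexp (4 * L ^ 2 / π) * rexp (-(π / 16) * (S : ℝ) ^ 2) := by
        rw [← Real.exp_add, Real.exp_le_exp, ← sub_nonneg]
        have : 4 * L ^ 2 / π + -(π / 16) * (S : ℝ) ^ 2 - (-(π / 8 * (S : ℝ) ^ 2) + S * L) =
            (2 * L - π / 4 * S) ^ 2 / π := by
          field_simp
          ring
        rw [this]
        positivity
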